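/- arXiv:1606.05034 — 2 statements merged into one kernel-verified Lean document; each statement's English description precedes it below -/
import Mathlib

section
/- Let λ > 0 and π ∈ (0,1). For each integer K ≥ 0 define μ(K) = λ π^{-1/(K+1)} (the counter decrement rate that yields caching probability π at threshold K) and the insertion rate ψ(K) = π (μ(K) - λ). Then ψ is strictly decreasing in K: ψ(K+1) < ψ(K) for all K ≥ 0. -/
/-- Holding the caching probability `p` fixed, the insertion rate
`ψ(K) = p (μ(K) - lam)`, where `μ(K) = lam · p^{-1/(K+1)}` is the decrement
rate achieving caching probability `p` at threshold `K`, is strictly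
decreasing in the threshold `K`. -/
theorem insertion_rate_strictly_decreasing_in_K
    (lam p : ℝ) (hlam : 0 < lam) (hp0 : 0 < p) (hp1 : p < 1)
    (mu ψ : ℕ → ℝ)
    (hmu : ∀ K : ℕ, mu K = lam * p ^ (-(1 / ((K : ℝ) + 1))))
    (hψ : ∀ K : ℕ, ψ K = p * (mu K - lam)) :
    ∀ K : ℕ, ψ (K + 1) < ψ K := by
  intro K
  have h_exp : -(1 / ((K : ℝ) + 1)) < -(1 / (((K + 1 : ℕ) : ℝ) + 1)) := by
    push_cast
    exact neg_lt_neg (one_div_lt_one_div_of_lt (by positivity) (by linarith))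
  have h_rpow := Real.rpow_lt_rpow_of_exponent_gt hp0 hp1 h_exp
  rw [hψ, hψ, hmu, hmu]
  gcongr
end

section
/- Let N ≥ 2 be an integer, π ∈ [0,1], and let j be an integer with 0 ≤ j ≤ N-1. Then (1-π) · Σ_{l=0}^{N-1-j} (C(N-1-l, j)/C(N-1, j)) · C(N-1, l) π^l (1-π)^{N-1-l} = (1-π)^{j+1}. -/
/-- Choosing disjoint subsets of sizes `l` and `j` from `j + m` elements, in either order. -/
theorem Nat.choose_sub_mul_choose_add (j : ℕ) {m l : ℕ} (h : l ≤ m) :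
    (j + m - l).choose j * (j + m).choose l = (j + m).choose j * m.choose l := by
  rw [← Nat.choose_symm (show l ≤ j + m by omega), mul_comm,
    Nat.choose_mul (by omega : j ≤ j + m - l)]
  rw [Nat.add_sub_cancel_left, show j + m - l - j = m - l by omega, Nat.choose_symm h]

/-- Pre-selected stateful search: unconditioning the hypergeometric
non-finding probability over the binomial number of replicas gives
`(1-p) Σ_{l=0}^{N-1-j} (C(N-1-l,j)/C(N-1,j)) C(N-1,l) p^l (1-p)^{N-1-l}
  = (1-p)^{j+1}`. -/
theorem preselected_stateful_tail
    (N : ℕ) (hN : 2 ≤ N) (p : ℝ) (hp0 : 0 ≤ p) (hp1 : p ≤ 1)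
    (j : ℕ) (hj : j ≤ N - 1) :
    (1 - p) * ∑ l ∈ Finset.range (N - j),
        (((N - 1 - l).choose j : ℝ) / ((N - 1).choose j : ℝ)) *
          ((N - 1).choose l : ℝ) * p ^ l * (1 - p) ^ (N - 1 - l)
      = (1 - p) ^ (j + 1) := by
  obtain ⟨m, rfl⟩ : ∃ m, N = j + m + 1 := ⟨N - 1 - j, by omega⟩
  have hpos : ((j + m).choose j : ℝ) ≠ 0 := by
    exact_mod_cast (Nat.choose_pos (Nat.le_add_right j m)).ne'
  have hterm : ∀ l ∈ Finset.range (m + 1),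
      (((j + m - l).choose j : ℝ) / ((j + m).choose j : ℝ)) *
          ((j + m).choose l : ℝ) * p ^ l * (1 - p) ^ (j + m - l)
        = (1 - p) ^ j * (p ^ l * (1 - p) ^ (m - l) * (m.choose l : ℝ)) := by
    intro l hl
    have hlm : l ≤ m := Nat.lt_succ_iff.mp (Finset.mem_range.mp hl)
    have hchoose : ((j + m - l).choose j : ℝ) * ((j + m).choose l : ℝ)
        = ((j + m).choose j : ℝ) * (m.choose l : ℝ) := by
      exact_mod_cast Nat.choose_sub_mul_choose_add j hlm
    rw [div_mul_eq_mul_div, hchoose, mul_div_cancel_left₀ _ hpos,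
      Nat.add_sub_assoc hlm, pow_add]
    ring
  rw [Nat.add_sub_cancel, show j + m + 1 - j = m + 1 by omega,
    Finset.sum_congr rfl hterm, ← Finset.mul_sum, ← add_pow, add_sub_cancel, one_pow]
  ring
end
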